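/- Let Σ be a finite alphabet and S ∈ Σ^∞ with dim_FS(S) = s. Then there exist natural numbers n₁ < n₂ < n₃ < … such that the sequence T = S[0…n₁]S[0…n₂]S[0…n₃]… obtained by concatenating the corresponding prefixes of S satisfies dim_FS(T) = s. -/

import Mathlib

/-- Number of sliding-block occurrences of `w` in `s`:
`N(w,s) = |{i : s[i…i+|w|−1] = w}|`. -/
def slideN {α : Type*} [DecidableEq α] (w s : List α) : ℕ :=
  ((Finset.range (s.length + 1 - w.length)).filter
    (fun i => ((s.drop i).take w.length) = w)).card

/-- Sliding count probability of `w` in `s`: `P(w,s) = N(w,s)/(|s|−|w|+1)`. -/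
noncomputable def slideP {α : Type*} [DecidableEq α] (w s : List α) : ℝ :=
  (slideN w s : ℝ) / ((s.length : ℝ) - (w.length : ℝ) + 1)

/-- `l`-th sliding block entropy of a string, with logarithms base `|α|`.
The convention `0 · log(1/0) = 0` holds automatically since `Real.logb b 0⁻¹ = 0`. -/
noncomputable def slideH {α : Type*} [Fintype α] [DecidableEq α] (l : ℕ) (x : List α) : ℝ :=
  (1 / (l : ℝ)) * ∑ w : Fin l → α,
    slideP (List.ofFn w) x * Real.logb (Fintype.card α) (slideP (List.ofFn w) x)⁻¹

/-- The prefix `S[0…n]` of a sequence, i.e. its first `n+1` symbols. -/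
def pre {α : Type*} (S : ℕ → α) (n : ℕ) : List α := List.ofFn (fun i : Fin (n + 1) => S i)

/-- Finite-state dimension via sliding block entropies:
`dim_FS(S) = inf_{l ≥ 1} liminf_{n→∞} H_l(S[0…n])`. -/
noncomputable def dimFS {α : Type*} [Fintype α] [DecidableEq α] (S : ℕ → α) : ℝ :=
  ⨅ l : ℕ, Filter.liminf (fun n => slideH (l + 1) (pre S n)) Filter.atTop

/-- Finite-state strong dimension:
`Dim_FS(S) = inf_{l ≥ 1} limsup_{n→∞} H_l(S[0…n])`. -/
noncomputable def DimFS {α : Type*} [Fintype α] [DecidableEq α] (S : ℕ → α) : ℝ :=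
  ⨅ l : ℕ, Filter.limsup (fun n => slideH (l + 1) (pre S n)) Filter.atTop
/-- Cumulative lengths of a sequence of lists. -/
def cumLen {α : Type*} (L : ℕ → List α) : ℕ → ℕ
  | 0 => 0
  | m + 1 => cumLen L m + (L m).length

open scoped Classical in
/-- The infinite sequence obtained by concatenating the lists `L 0, L 1, L 2, …`
(a default symbol is used in the degenerate case where the total length is finite). -/
noncomputable def concatSeq {α : Type*} (dflt : α) (L : ℕ → List α) (k : ℕ) : α :=
  if h : ∃ m, k < cumLen L (m + 1) then
    (L (Nat.find h)).getD (k - cumLen L (Nat.find h)) dflt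
  else dflt

open Filter Topology

/-- The length-`l` block of `S` starting at position `i`. -/
def blockAt {α : Type*} (S : ℕ → α) (l i : ℕ) : Fin l → α := fun j => S (i + j)

/-- Number of occurrences of `w` among the first `N` length-`l` blocks of `S`. -/
def blockCount {α : Type*} [DecidableEq α] (S : ℕ → α) {l : ℕ} (w : Fin l → α) (N : ℕ) : ℕ :=
  Nat.count (fun i => blockAt S l i = w) N

/-- Frequency of `w` among the first `N` length-`l` blocks of `S`. -/
noncomputable def blockFreq {α : Type*} [DecidableEq α] (S : ℕ → α) {l : ℕ} (w : Fin l → α)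
    (N : ℕ) : ℝ :=
  blockCount S w N / N

/-- Entropy-like functional `∑ w, η (freq w)` of the first `N` length-`l` blocks of `S`. -/
noncomputable def blockEnt {α : Type*} [Fintype α] [DecidableEq α] (η : ℝ → ℝ) (S : ℕ → α)
    (l N : ℕ) : ℝ :=
  ∑ w : Fin l → α, η (blockFreq S w N)

/-- `T` is the concatenation of the prefixes of `S` of lengths `m 0, m 1, …`, the `j`-th one
starting at position `c j`. -/
structure IsPrefixConcat {α : Type*} (S T : ℕ → α) (c m : ℕ → ℕ) : Prop where
  zero : c 0 = 0
  succ : ∀ j, c (j + 1) = c j + m j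
  apply_add : ∀ j, ∀ t < m j, T (c j + t) = S t

section Blocks

variable {α : Type*} [DecidableEq α]

lemma blockCount_le (S : ℕ → α) {l : ℕ} (w : Fin l → α) (N : ℕ) : blockCount S w N ≤ N :=
  Nat.count_le _

lemma blockFreq_mem (S : ℕ → α) {l : ℕ} (w : Fin l → α) (N : ℕ) :
    blockFreq S w N ∈ Set.Icc (0 : ℝ) 1 :=
  ⟨by unfold blockFreq; positivity,
    div_le_one_of_le₀ (by exact_mod_cast blockCount_le S w N) (by positivity)⟩

lemma mul_blockFreq (S : ℕ → α) {l : ℕ} (w : Fin l → α) (N : ℕ) :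
    (N : ℝ) * blockFreq S w N = blockCount S w N := by
  rcases Nat.eq_zero_or_pos N with rfl | h
  · simp [blockCount]
  · unfold blockFreq
    field_simp

lemma slideN_pre (S : ℕ → α) {l : ℕ} (w : Fin l → α) (n : ℕ) :
    slideN (List.ofFn w) (pre S n) = blockCount S w (n + 2 - l) := by
  unfold slideN blockCount
  rw [Nat.count_eq_card_filter_range]
  simp only [pre, List.length_ofFn]
  congr 1
  apply Finset.filter_congr
  intro i hi
  rw [Finset.mem_range] at hi
  constructor
  · intro h
    funext j
    have := congrArg (fun L => L[(j : ℕ)]?) h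
    have hj := j.2
    simp only [List.getElem?_take, hj, if_true, List.getElem?_drop] at this
    rw [List.getElem?_eq_getElem (by simp; omega), List.getElem?_eq_getElem (by simp)] at this
    simpa [blockAt, -List.ofFn_succ] using this
  · rintro rfl
    apply List.ext_getElem
    · simp; omega
    · intro j h1 h2
      simp [blockAt, -List.ofFn_succ]

lemma count_le_count_add {p q : ℕ → Prop} [DecidablePred p] [DecidablePred q] {l M : ℕ}
    (h : ∀ t, t + l < M → p t → q t) : Nat.count p M ≤ Nat.count q M + l := by
  calc Nat.count p M ≤ Nat.count p (M - l + l) := Nat.count_monotone _ (by omega)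
    _ ≤ Nat.count p (M - l) + l := by
        rw [Nat.count_add]
        exact Nat.add_le_add_left (Nat.count_le _) _
    _ ≤ Nat.count q (M - l) + l :=
        Nat.add_le_add_right (Nat.count_mono_left fun k hk => h k (by omega)) _
    _ ≤ Nat.count q M + l := Nat.add_le_add_right (Nat.count_monotone _ (by omega)) _

variable {S T : ℕ → α} {c m : ℕ → ℕ}

lemma IsPrefixConcat.abs_count_segment_sub_le (h : IsPrefixConcat S T c m) {l : ℕ}
    (w : Fin l → α) {j M : ℕ} (hM : M ≤ m j) :
    |(Nat.count (fun t => blockAt T l (c j + t) = w) M : ℝ) - blockCount S w M| ≤ l := by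
  have key : ∀ t, t + l < M → blockAt T l (c j + t) = blockAt S l t := by
    intro t ht
    funext i
    have hi := i.2
    simp only [blockAt, add_assoc]
    exact h.apply_add j _ (by omega)
  have h1 : Nat.count (fun t => blockAt T l (c j + t) = w) M ≤ blockCount S w M + l :=
    count_le_count_add fun t ht => by rw [key t ht]; exact id
  have h2 : blockCount S w M ≤ Nat.count (fun t => blockAt T l (c j + t) = w) M + l :=
    count_le_count_add fun t ht => by rw [key t ht]; exact id
  rw [abs_sub_le_iff]
  constructor
  · rw [sub_le_iff_le_add']; exact_mod_cast h1
  · rw [sub_le_iff_le_add']; exact_mod_cast h2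

lemma IsPrefixConcat.abs_blockCount_sub_le (h : IsPrefixConcat S T c m) {l : ℕ}
    (w : Fin l → α) (j : ℕ) : ∀ {k : ℕ}, k ≤ m j →
    |(blockCount T w (c j + k) : ℝ)
      - (∑ i ∈ Finset.range j, (blockCount S w (m i) : ℝ) + blockCount S w k)| ≤ l * (j + 1) := by
  induction j with
  | zero =>
    intro k hk
    have := h.abs_count_segment_sub_le w hk
    simpa [h.zero, blockCount] using this
  | succ j ih =>
    intro k hk
    have h1 := ih le_rfl
    have h2 := h.abs_count_segment_sub_le w hk
    rw [← h.succ] at h1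
    rw [Finset.sum_range_succ]
    have h3 : blockCount T w (c (j + 1) + k) = blockCount T w (c (j + 1))
        + Nat.count (fun t => blockAt T l (c (j + 1) + t) = w) k := Nat.count_add _ _ _
    rw [h3]
    rw [abs_le] at *
    push_cast
    constructor <;> linarith [h1.1, h1.2, h2.1, h2.2]

omit [DecidableEq α] in
lemma IsPrefixConcat.start_eq_sum (h : IsPrefixConcat S T c m) (j : ℕ) :
    c j = ∑ i ∈ Finset.range j, m i := by
  induction j with
  | zero => simp [h.zero]
  | succ j ih => rw [h.succ, Finset.sum_range_succ, ih]

end Blocks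

section Entropy

variable {α : Type*} [Fintype α] [DecidableEq α] {S T : ℕ → α} {c m : ℕ → ℕ} {η : ℝ → ℝ}

lemma blockEnt_nonneg (hη : ∀ x ∈ Set.Icc (0 : ℝ) 1, 0 ≤ η x) (S : ℕ → α) (l N : ℕ) :
    0 ≤ blockEnt η S l N :=
  Finset.sum_nonneg fun w _ => hη _ (blockFreq_mem S w N)

lemma exists_blockEnt_le (hc : Continuous η) (S : ℕ → α) (l : ℕ) :
    ∃ B, ∀ N, blockEnt η S l N ≤ B := by
  obtain ⟨B, hB⟩ := (isCompact_Icc (a := (0 : ℝ)) (b := 1)).bddAbove_image hc.continuousOn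
  refine ⟨∑ _w : Fin l → α, B, fun N => Finset.sum_le_sum fun w _ => ?_⟩
  exact hB ⟨_, blockFreq_mem S w N, rfl⟩

/-- Uniform continuity of `q ↦ ∑ w, η (q w)` on `[0, 1]`-valued vectors. -/
lemma exists_abs_sum_sub_le {ι : Type*} [Fintype ι] (hc : Continuous η) {ε : ℝ} (hε : 0 < ε) :
    ∃ δ > 0, ∀ p q : ι → ℝ, (∀ i, p i ∈ Set.Icc (0 : ℝ) 1) → (∀ i, q i ∈ Set.Icc (0 : ℝ) 1) →
      (∀ i, |p i - q i| < δ) → |∑ i, η (p i) - ∑ i, η (q i)| ≤ ε := by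
  have hu := (isCompact_Icc (a := (0 : ℝ)) (b := 1)).uniformContinuousOn_of_continuous
    hc.continuousOn
  rw [Metric.uniformContinuousOn_iff] at hu
  have hK : (0 : ℝ) < Fintype.card ι + 1 := by positivity
  obtain ⟨δ, hδ, h⟩ := hu (ε / (Fintype.card ι + 1)) (by positivity)
  refine ⟨δ, hδ, fun p q hp hq hpq => ?_⟩
  rw [← Finset.sum_sub_distrib]
  calc |∑ i, (η (p i) - η (q i))| ≤ ∑ i, |η (p i) - η (q i)| := Finset.abs_sum_le_sum_abs _ _
    _ ≤ ∑ _i : ι, ε / (Fintype.card ι + 1) :=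
        Finset.sum_le_sum fun i _ => (h _ (hp i) _ (hq i) (hpq i)).le
    _ = Fintype.card ι / (Fintype.card ι + 1) * ε := by
        rw [Finset.sum_const, Finset.card_univ, nsmul_eq_mul]; ring
    _ ≤ 1 * ε := by
        gcongr
        rw [div_le_one hK]; linarith
    _ = ε := one_mul ε

/-- Jensen's inequality for a mixture of block frequencies of prefixes. -/
lemma sum_mul_blockEnt_le (hη : ConcaveOn ℝ (Set.Ici 0) η) (S : ℕ → α) (l : ℕ) {ι : Type*}
    (s : Finset ι) (M : ι → ℕ) {N : ℕ} (hN : 0 < N) (hM : ∑ i ∈ s, M i = N) :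
    ∑ i ∈ s, (M i : ℝ) * blockEnt η S l (M i)
      ≤ N * ∑ w : Fin l → α, η ((∑ i ∈ s, (blockCount S w (M i) : ℝ)) / N) := by
  have hN' : (0 : ℝ) < N := by exact_mod_cast hN
  have key (w : Fin l → α) : ∑ i ∈ s, ((M i : ℝ) / N) * η (blockFreq S w (M i))
      ≤ η ((∑ i ∈ s, (blockCount S w (M i) : ℝ)) / N) := by
    have := hη.le_map_sum (t := s) (w := fun i => (M i : ℝ) / N)
      (p := fun i => blockFreq S w (M i)) (fun i _ => by positivity)
      (by rw [← Finset.sum_div, div_eq_one_iff_eq hN'.ne']; exact_mod_cast hM)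
      (fun i _ => (blockFreq_mem S w _).1)
    simp only [smul_eq_mul] at this
    refine this.trans_eq (congrArg η ?_)
    rw [Finset.sum_div]
    refine Finset.sum_congr rfl fun i _ => ?_
    rw [← mul_blockFreq]; ring
  calc ∑ i ∈ s, (M i : ℝ) * blockEnt η S l (M i)
      = N * ∑ w : Fin l → α, ∑ i ∈ s, ((M i : ℝ) / N) * η (blockFreq S w (M i)) := by
        rw [Finset.sum_comm, Finset.mul_sum]
        refine Finset.sum_congr rfl fun i _ => ?_
        rw [← Finset.mul_sum, ← mul_assoc, mul_div_cancel₀ _ hN'.ne', blockEnt]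
    _ ≤ _ := by
        gcongr with w
        exact key w

omit [Fintype α] [DecidableEq α] in
lemma IsPrefixConcat.exists_decomp (h : IsPrefixConcat S T c m) (hm : ∀ j, 0 < m j) (N : ℕ) :
    ∃ j k, k ≤ m j ∧ N = c j + k := by
  have hmono : StrictMono c := strictMono_nat_of_lt_succ fun j => by
    rw [h.succ]; exact Nat.lt_add_of_pos_right (hm j)
  have hex : ∃ j, N < c (j + 1) := ⟨N, hmono.le_apply⟩
  classical
  refine ⟨Nat.find hex, N - c (Nat.find hex), ?_, ?_⟩
  · have := Nat.find_spec hex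
    rw [h.succ] at this
    omega
  · have : c (Nat.find hex) ≤ N := by
      rcases hj : Nat.find hex with _ | j
      · simp [h.zero]
      · have := Nat.find_min hex (m := j) (by omega)
        omega
    omega

lemma IsPrefixConcat.eventually_le_blockEnt (h : IsPrefixConcat S T c m) (hm : ∀ j, 0 < m j)
    (hc : ∀ j, j * j ≤ c j) (hη : ConcaveOn ℝ (Set.Ici 0) η) (hcont : Continuous η)
    (hpos : ∀ x ∈ Set.Icc (0 : ℝ) 1, 0 ≤ η x) (l : ℕ) {A ε : ℝ} (hε : 0 < ε)
    (hA : ∀ᶠ N in atTop, A ≤ blockEnt η S l N) :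
    ∀ᶠ N in atTop, A - ε ≤ blockEnt η T l N := by
  obtain ⟨M₀, hM₀⟩ := eventually_atTop.1 hA
  set C : ℝ := M₀ * |A| with hC
  have hC0 : 0 ≤ C := by positivity
  have hlow (M : ℕ) : A * M - C ≤ M * blockEnt η S l M := by
    rcases le_or_gt M₀ M with hM | hM
    · have := hM₀ M hM
      have : (M : ℝ) * A ≤ M * blockEnt η S l M := by gcongr
      linarith
    · have h1 : A * M ≤ M₀ * |A| := by
        rw [mul_comm]
        have : (M : ℝ) ≤ M₀ := by exact_mod_cast hM.le
        calc (M : ℝ) * A ≤ M * |A| := by gcongr; exact le_abs_self A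
          _ ≤ _ := by gcongr
      have h2 : 0 ≤ (M : ℝ) * blockEnt η S l M :=
        mul_nonneg (by positivity) (blockEnt_nonneg hpos S l M)
      linarith
  obtain ⟨δ, hδ, hunif⟩ :=
    exists_abs_sum_sub_le (ι := Fin l → α) hcont (half_pos hε)
  set D : ℝ := l + C + 1 with hD
  have hD0 : 0 < D := by positivity
  set γ : ℝ := min (δ / 2) (ε / 2) / D with hγ
  have hγ0 : 0 < γ := by positivity
  have hev : ∀ᶠ N : ℕ in atTop, 2 / γ ≤ √(N : ℝ) :=
    (Real.tendsto_sqrt_atTop.comp tendsto_natCast_atTop_atTop).eventually_ge_atTop _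
  filter_upwards [hev, eventually_ge_atTop 1] with N hN hN1
  obtain ⟨j, k, hk, rfl⟩ := h.exists_decomp hm N
  set N := c j + k with hNdef
  have hNpos : (0 : ℝ) < N := by exact_mod_cast hN1
  have hjN : (j : ℝ) + 1 ≤ γ * N := by
    have h1 : (j : ℝ) ≤ √N := by
      apply Real.le_sqrt_of_sq_le
      have : j * j ≤ N := (hc j).trans (by omega)
      rw [sq]; exact_mod_cast this
    have h2 : 1 ≤ √(N : ℝ) := Real.one_le_sqrt.2 (by exact_mod_cast hN1)
    have h3 : √(N : ℝ) * √N = N := Real.mul_self_sqrt hNpos.le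
    have h4 : 2 ≤ γ * √N := by rwa [div_le_iff₀' hγ0] at hN
    nlinarith
  have hDj : D * (j + 1) ≤ min (δ / 2) (ε / 2) * N := by
    calc D * ((j : ℝ) + 1) ≤ D * (γ * N) := by gcongr
      _ = _ := by rw [hγ]; field_simp
  set M : ℕ → ℕ := fun i => if i < j then m i else k with hM
  have hMsum {β : Type} [AddCommMonoid β] (f : ℕ → β) :
      ∑ i ∈ Finset.range (j + 1), f (M i) = ∑ i ∈ Finset.range j, f (m i) + f k := by
    rw [Finset.sum_range_succ]
    congr 1
    · exact Finset.sum_congr rfl fun i hi => by simp [hM, Finset.mem_range.1 hi]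
    · simp [hM]
  have hMN : ∑ i ∈ Finset.range (j + 1), M i = N := by
    rw [hMsum (fun x => x), ← h.start_eq_sum]
  have hMN' : ∑ i ∈ Finset.range (j + 1), (M i : ℝ) = N := by exact_mod_cast hMN
  have hJ := sum_mul_blockEnt_le hη S l (Finset.range (j + 1)) M hN1 hMN
  have hsum : A * N - C * (j + 1) ≤
      ∑ i ∈ Finset.range (j + 1), (M i : ℝ) * blockEnt η S l (M i) := by
    calc A * N - C * (j + 1) = ∑ i ∈ Finset.range (j + 1), (A * M i - C) := by
          rw [Finset.sum_sub_distrib, ← Finset.mul_sum, hMN']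
          simp; ring
      _ ≤ _ := Finset.sum_le_sum fun i _ => hlow (M i)
  have hclose := hunif (fun w => blockFreq T w N)
    (fun w => (∑ i ∈ Finset.range (j + 1), (blockCount S w (M i) : ℝ)) / N)
    (fun w => blockFreq_mem T w N)
    (fun w => ⟨by positivity, div_le_one_of_le₀ (by
      rw [← hMN']
      exact Finset.sum_le_sum fun i _ => by exact_mod_cast blockCount_le S w (M i))
      (by positivity)⟩)
    (fun w => by
      rw [blockFreq, ← sub_div, abs_div, abs_of_pos hNpos, div_lt_iff₀ hNpos,
        hMsum (fun x => (blockCount S w x : ℝ))]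
      have h1 := h.abs_blockCount_sub_le w j hk
      have h2 : (l : ℝ) * (j + 1) ≤ D * (j + 1) := by gcongr; rw [hD]; linarith
      have h3 : min (δ / 2) (ε / 2) * N ≤ δ / 2 * N := by gcongr; exact min_le_left _ _
      have h4 : δ / 2 * N < δ * N := by gcongr; linarith
      linarith)
  rw [abs_le] at hclose
  have h5 : C * (j + 1) ≤ ε / 2 * N := by
    have h2 : C * (j + 1) ≤ D * (j + 1) := by
      gcongr; rw [hD]; linarith [Nat.cast_nonneg (α := ℝ) l]
    have h3 : min (δ / 2) (ε / 2) * N ≤ ε / 2 * N := by gcongr; exact min_le_right _ _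
    linarith
  have h6 : N * (A - ε / 2) ≤ N * ∑ w : Fin l → α,
      η ((∑ i ∈ Finset.range (j + 1), (blockCount S w (M i) : ℝ)) / N) := by
    linarith
  have h7 := le_of_mul_le_mul_left h6 hNpos
  rw [blockEnt]
  linarith [hclose.1]

lemma IsPrefixConcat.eventually_abs_blockEnt_sub_le (h : IsPrefixConcat S T c m)
    (hcm : ∀ j, (j + 1) * (c j + 1) ≤ m j) (hcont : Continuous η) (l : ℕ) {ε : ℝ} (hε : 0 < ε) :
    ∀ᶠ j in atTop, |blockEnt η T l (c (j + 1)) - blockEnt η S l (m j)| ≤ ε := by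
  obtain ⟨δ, hδ, hunif⟩ := exists_abs_sum_sub_le (ι := Fin l → α) hcont hε
  filter_upwards [tendsto_natCast_atTop_atTop.eventually_gt_atTop ((2 + l) / δ)] with j hj
  refine hunif _ _ (fun w => blockFreq_mem T w _) (fun w => blockFreq_mem S w _) fun w => ?_
  have hm1 : 1 ≤ m j := le_trans (Nat.one_le_iff_ne_zero.2 (by positivity)) (hcm j)
  have hm0 : (0 : ℝ) < m j := by exact_mod_cast hm1
  have hseg := h.abs_count_segment_sub_le w (le_refl (m j))
  have hsplit : blockCount T w (c (j + 1)) = blockCount T w (c j)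
      + Nat.count (fun t => blockAt T l (c j + t) = w) (m j) := by
    rw [h.succ]; exact Nat.count_add _ _ _
  have hN : (c (j + 1) : ℝ) = c j + m j := by rw [h.succ]; push_cast; rfl
  have hN0 : (0 : ℝ) < c (j + 1) := by rw [hN]; positivity
  have hq := blockFreq_mem S w (m j)
  have hTc : (blockCount T w (c j) : ℝ) ≤ c j := by exact_mod_cast blockCount_le T w (c j)
  have hcm' : ((j : ℝ) + 1) * (c j + 1) ≤ m j := by exact_mod_cast hcm j
  have hbig : (2 + l : ℝ) * (c j + 1) < δ * c (j + 1) := by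
    rw [div_lt_iff₀' hδ] at hj
    have hcp : (0 : ℝ) < c j + 1 := by positivity
    calc (2 + l : ℝ) * (c j + 1) < δ * j * (c j + 1) := by gcongr
      _ ≤ δ * (((j : ℝ) + 1) * (c j + 1)) := by
        rw [mul_assoc]; gcongr; linarith
      _ ≤ δ * m j := by gcongr
      _ ≤ δ * c (j + 1) := by gcongr; rw [h.succ]; omega
  have hrepr : blockFreq T w (c (j + 1)) - blockFreq S w (m j)
      = (blockCount T w (c j) + (Nat.count (fun t => blockAt T l (c j + t) = w) (m j) -
        blockCount S w (m j)) - c j * blockFreq S w (m j)) / c (j + 1) := by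
    rw [eq_div_iff hN0.ne', sub_mul, mul_comm, mul_blockFreq, hsplit, hN, mul_add,
      mul_comm _ (m j : ℝ), mul_blockFreq]
    push_cast; ring
  rw [hrepr, abs_div, abs_of_pos hN0, div_lt_iff₀ hN0]
  refine lt_of_le_of_lt ?_ hbig
  have h0 : (0 : ℝ) ≤ blockCount T w (c j) := by positivity
  have hc0 : (0 : ℝ) ≤ c j := by positivity
  have hl0 : (0 : ℝ) ≤ l * c j := by positivity
  have h1 : 0 ≤ c j * blockFreq S w (m j) := mul_nonneg hc0 hq.1
  have h2 : c j * blockFreq S w (m j) ≤ c j := mul_le_of_le_one_right hc0 hq.2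
  rw [abs_le] at hseg ⊢
  constructor <;> nlinarith [hseg.1, hseg.2]

end Entropy

section Dimension

variable {α : Type*} [Fintype α] [DecidableEq α]

/-- The summand of the normalised base-`b` entropy of length-`l` blocks. -/
noncomputable def entropySummand (b l : ℕ) (x : ℝ) : ℝ :=
  1 / (l * Real.log b) * Real.negMulLog x

lemma entropySummand_coeff_nonneg (b l : ℕ) : 0 ≤ 1 / (l * Real.log b) := by
  have := Real.log_natCast_nonneg b
  positivity

lemma continuous_entropySummand (b l : ℕ) : Continuous (entropySummand b l) :=
  continuous_const.mul Real.continuous_negMulLog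

lemma concaveOn_entropySummand (b l : ℕ) : ConcaveOn ℝ (Set.Ici 0) (entropySummand b l) :=
  Real.concaveOn_negMulLog.smul (entropySummand_coeff_nonneg b l)

lemma entropySummand_nonneg (b l : ℕ) (x : ℝ) (hx : x ∈ Set.Icc (0 : ℝ) 1) :
    0 ≤ entropySummand b l x :=
  mul_nonneg (entropySummand_coeff_nonneg b l) (Real.negMulLog_nonneg hx.1 hx.2)

lemma slideH_pre (S : ℕ → α) {l n : ℕ} (h : l ≤ n + 2) :
    slideH l (pre S n) = blockEnt (entropySummand (Fintype.card α) l) S l (n + 2 - l) := by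
  unfold slideH blockEnt
  rw [Finset.mul_sum]
  refine Finset.sum_congr rfl fun w _ => ?_
  have hP : slideP (List.ofFn w) (pre S n) = blockFreq S w (n + 2 - l) := by
    rw [slideP, slideN_pre, blockFreq, Nat.cast_sub h]
    simp only [pre, List.length_ofFn]
    congr 1
    push_cast
    ring
  rw [hP, entropySummand, Real.negMulLog, Real.logb, Real.log_inv, one_div, one_div, mul_inv]
  ring

lemma liminf_slideH_pre (S : ℕ → α) (l : ℕ) :
    liminf (fun n => slideH l (pre S n)) atTop
      = liminf (blockEnt (entropySummand (Fintype.card α) l) S l) atTop := by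
  have hmap : map (fun n => n + 2 - l) atTop = atTop := by
    have := map_map (f := (atTop : Filter ℕ)) (m := fun n => n + 2) (m' := fun n => n - l)
    rw [map_add_atTop_eq_nat, map_sub_atTop_eq_nat] at this
    exact this.symm
  conv_rhs => rw [← hmap, ← liminf_comp]
  refine liminf_congr ?_
  filter_upwards [eventually_ge_atTop l] with n hn
  exact slideH_pre S (by omega)

omit [Fintype α] [DecidableEq α] in
lemma isPrefixConcat_concatSeq (S : ℕ → α) (d : α) (n : ℕ → ℕ) :
    IsPrefixConcat S (concatSeq d (fun i => pre S (n i))) (cumLen fun i => pre S (n i))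
      (fun i => n i + 1) := by
  set L : ℕ → List α := fun i => pre S (n i) with hL
  have hsucc (j : ℕ) : cumLen L (j + 1) = cumLen L j + (n j + 1) := by
    simp [cumLen, hL, pre]
  have hmono : Monotone (cumLen L) := monotone_nat_of_le_succ fun j => by
    rw [hsucc]; exact Nat.le_add_right _ _
  refine ⟨rfl, hsucc, fun j t ht => ?_⟩
  have hlt : cumLen L j + t < cumLen L (j + 1) := by rw [hsucc]; omega
  have hex : ∃ i, cumLen L j + t < cumLen L (i + 1) := ⟨j, hlt⟩
  have hfind (inst : DecidablePred fun i => cumLen L j + t < cumLen L (i + 1)) :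
      Nat.find hex = j := by
    rw [Nat.find_eq_iff]
    refine ⟨hlt, fun i hi => ?_⟩
    have := hmono (show i + 1 ≤ j from hi)
    omega
  rw [concatSeq, dif_pos hex, hfind, Nat.add_sub_cancel_left, List.getD_eq_getElem _ _ (by
    simpa [hL, pre, -List.ofFn_succ] using ht)]
  simp [hL, pre, -List.ofFn_succ]

variable {S T : ℕ → α} {c m : ℕ → ℕ} {η : ℝ → ℝ}

lemma isBoundedUnder_ge_blockEnt (hpos : ∀ x ∈ Set.Icc (0 : ℝ) 1, 0 ≤ η x) (S : ℕ → α) (l : ℕ) :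
    IsBoundedUnder (· ≥ ·) atTop (blockEnt η S l) :=
  isBoundedUnder_of ⟨0, blockEnt_nonneg hpos S l⟩

lemma isCoboundedUnder_ge_blockEnt (hcont : Continuous η) (S : ℕ → α) (l : ℕ) :
    IsCoboundedUnder (· ≥ ·) atTop (blockEnt η S l) := by
  obtain ⟨B, hB⟩ := exists_blockEnt_le hcont S l
  exact (isBoundedUnder_of ⟨B, hB⟩ : IsBoundedUnder (· ≤ ·) atTop _).isCoboundedUnder_ge

lemma IsPrefixConcat.liminf_blockEnt_eq (h : IsPrefixConcat S T c m)
    (hcm : ∀ j, (j + 1) * (c j + 1) ≤ m j) (hη : ConcaveOn ℝ (Set.Ici 0) η)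
    (hcont : Continuous η) (hpos : ∀ x ∈ Set.Icc (0 : ℝ) 1, 0 ≤ η x) (l : ℕ)
    (hfreq : ∀ ε > 0, ∃ᶠ j in atTop,
      blockEnt η S l (m j) ≤ liminf (blockEnt η S l) atTop + ε) :
    liminf (blockEnt η T l) atTop = liminf (blockEnt η S l) atTop := by
  have hm (j : ℕ) : 0 < m j :=
    lt_of_lt_of_le (Nat.mul_pos (Nat.succ_pos _) (Nat.succ_pos _)) (hcm j)
  have hsq (j : ℕ) : j * j ≤ c j := by
    induction j with
    | zero => simp
    | succ j ih =>
      rw [h.succ]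
      nlinarith [hcm j, Nat.zero_le (j * c j)]
  apply le_antisymm
  · refine le_of_forall_pos_le_add fun ε hε => ?_
    refine liminf_le_of_frequently_le ?_ (isBoundedUnder_ge_blockEnt hpos T l)
    have hstep : ∃ᶠ j in atTop,
        blockEnt η T l (c (j + 1)) ≤ liminf (blockEnt η S l) atTop + ε := by
      refine ((hfreq (ε / 2) (half_pos hε)).and_eventually
        (h.eventually_abs_blockEnt_sub_le hcm hcont l (half_pos hε))).mono fun j hj => ?_
      linarith [hj.1, (abs_le.1 hj.2).2]
    have htend : Tendsto (fun j => c (j + 1)) atTop atTop :=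
      tendsto_atTop_mono (fun j => show j ≤ c (j + 1) by
        nlinarith [hsq (j + 1)]) tendsto_id
    exact htend.frequently hstep
  · refine le_of_forall_pos_sub_le fun ε hε => ?_
    refine le_liminf_of_le (isCoboundedUnder_ge_blockEnt hcont T l) ?_
    have hA : ∀ᶠ N in atTop, liminf (blockEnt η S l) atTop - ε / 2 ≤ blockEnt η S l N :=
      (eventually_lt_of_lt_liminf (sub_lt_self _ (half_pos hε))
        (isBoundedUnder_ge_blockEnt hpos S l)).mono fun _ => le_of_lt
    filter_upwards [h.eventually_le_blockEnt hm hsq hη hcont hpos l (half_pos hε) hA] with N hN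
    linarith

lemma exists_ge_blockEnt_le (hcont : Continuous η) (S : ℕ → α) (l : ℕ) {ε : ℝ} (hε : 0 < ε)
    (C : ℕ) : ∃ n ≥ C, blockEnt η S l (n + 1) ≤ liminf (blockEnt η S l) atTop + ε := by
  obtain ⟨N, hN, hle⟩ := frequently_atTop.1 (frequently_lt_of_liminf_lt
    (isCoboundedUnder_ge_blockEnt hcont S l) (lt_add_of_pos_right _ hε)) (C + 1)
  refine ⟨N - 1, by omega, ?_⟩
  rw [Nat.sub_add_cancel (by omega)]
  exact hle.le

/-- Prefix lengths growing fast compared with all earlier ones, and such that for every `l` the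
`l`-block entropies along them come arbitrarily close to their lower limit. -/
lemma exists_prefix_lengths {η : ℕ → ℝ → ℝ} (hcont : ∀ l, Continuous (η l)) (S : ℕ → α) :
    ∃ n : ℕ → ℕ, StrictMono n ∧
      (∀ j, (j + 1) * (cumLen (fun i => pre S (n i)) j + 1) ≤ n j + 1) ∧
      ∀ l, ∀ ε > 0, ∃ᶠ j in atTop,
        blockEnt (η l) S l (n j + 1) ≤ liminf (blockEnt (η l) S l) atTop + ε := by
  have hex (j C : ℕ) := exists_ge_blockEnt_le (hcont j.unpair.1) S j.unpair.1
    (Nat.one_div_pos_of_nat (α := ℝ) (n := j)) ((j + 1) * (C + 1))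
  choose F hF hFle using hex
  let c : ℕ → ℕ := Nat.rec 0 fun j C => C + (F j C + 1)
  have hcum (j : ℕ) : cumLen (fun i => pre S (F i (c i))) j = c j := by
    induction j with
    | zero => rfl
    | succ j ih =>
      rw [cumLen, ih]
      simp [pre, c, -List.ofFn_succ]
  refine ⟨fun j => F j (c j), strictMono_nat_of_lt_succ fun j => ?_, fun j => ?_,
    fun l ε hε => ?_⟩
  · have h1 : c (j + 1) = c j + (F j (c j) + 1) := rfl
    have h2 := hF (j + 1) (c (j + 1))
    nlinarith
  · rw [hcum]
    exact (hF j (c j)).trans (Nat.le_succ _)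
  · rw [frequently_atTop]
    intro K
    obtain ⟨K', hK'⟩ := exists_nat_one_div_lt hε
    refine ⟨Nat.pair l (max K K'), (le_max_left _ _).trans (Nat.right_le_pair _ _), ?_⟩
    have h1 := hFle (Nat.pair l (max K K')) (c (Nat.pair l (max K K')))
    have h2 : (1 : ℝ) / ((Nat.pair l (max K K') : ℕ) + 1) ≤ 1 / (K' + 1) := by
      have : (K' : ℝ) ≤ (Nat.pair l (max K K') : ℕ) := by
        exact_mod_cast (le_max_right K K').trans (Nat.right_le_pair _ _)
      gcongr
    rw [Nat.unpair_pair] at h1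
    simp only at h1
    linarith

end Dimension

/-- For every sequence `S` with `dim_FS(S) = s` there are natural
numbers `n₁ < n₂ < n₃ < …` such that the concatenation of prefixes
`T = S[0…n₁]S[0…n₂]S[0…n₃]…` satisfies `dim_FS(T) = s`. -/
theorem stmt3 {α : Type*} [Fintype α] [DecidableEq α] [Inhabited α]
    (hα : 2 ≤ Fintype.card α) (S : ℕ → α) (s : ℝ) (hS : dimFS S = s) :
    ∃ n : ℕ → ℕ, StrictMono n ∧
      dimFS (concatSeq default (fun i => pre S (n i))) = s := by
  obtain ⟨n, hn, hgrow, hfreq⟩ :=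
    exists_prefix_lengths (continuous_entropySummand (Fintype.card α)) S
  refine ⟨n, hn, ?_⟩
  rw [← hS, dimFS, dimFS]
  congr 1
  funext l
  rw [liminf_slideH_pre, liminf_slideH_pre]
  exact (isPrefixConcat_concatSeq S default n).liminf_blockEnt_eq hgrow
    (concaveOn_entropySummand _ _) (continuous_entropySummand _ _)
    (entropySummand_nonneg _ _) (l + 1) (hfreq (l + 1))
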